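/- arXiv:1407.0597 — 2 statements merged into one kernel-verified Lean document; each statement's English description precedes it below -/
import Mathlib

section
/- Assume that for every p in the support D of μ the map d ↦ r(d,p) is convex on ℝᵐ, and that for every d ∈ ℝᵐ one has μ({p : r(d,p) = α_β(d)}) = 0. Then the conditional value-at-risk φ_β is a convex function of d on ℝᵐ. -/
open MeasureTheory

/-- The distribution function of a probability measure on `ℝ` takes the value `β` at its
`β`-quantile whenever the quantile is not an atom. -/
theorem cdf_sInf_eq_of_measure_singleton_eq_zero (ν : Measure ℝ) [IsProbabilityMeasure ν]
    {β : ℝ} (hβ : β ∈ Set.Ioo (0 : ℝ) 1)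
    (h : ν {sInf {α : ℝ | β ≤ ProbabilityTheory.cdf ν α}} = 0) :
    ProbabilityTheory.cdf ν (sInf {α : ℝ | β ≤ ProbabilityTheory.cdf ν α}) = β := by
  set F := ProbabilityTheory.cdf ν with hF
  set S := {α : ℝ | β ≤ F α} with hS
  have hne : S.Nonempty :=
    (((ProbabilityTheory.tendsto_cdf_atTop ν).eventually (lt_mem_nhds hβ.2)).exists).imp
      fun _ hx => le_of_lt hx
  have hbdd : BddBelow S := by
    obtain ⟨a, ha⟩ :=
      ((ProbabilityTheory.tendsto_cdf_atBot ν).eventually (gt_mem_nhds hβ.1)).exists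
    refine ⟨a, fun x hx => ?_⟩
    by_contra! hxa
    exact absurd (F.mono hxa.le) (not_le.2 (lt_of_lt_of_le ha hx))
  have hcont : ContinuousAt F (sInf S) := by
    rw [← ProbabilityTheory.measure_cdf ν, StieltjesFunction.measure_singleton,
      ENNReal.ofReal_eq_zero] at h
    rw [F.mono.continuousAt_iff_leftLim_eq_rightLim, F.rightLim_eq]
    exact le_antisymm (F.mono.leftLim_le le_rfl) (by linarith)
  apply le_antisymm
  · refine le_of_tendsto (hcont.tendsto.mono_left nhdsWithin_le_nhds :
      Filter.Tendsto F (nhdsWithin (sInf S) (Set.Iio (sInf S))) _) ?_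
    filter_upwards [self_mem_nhdsWithin] with x hx
    exact (not_le.1 fun hxS => notMem_of_lt_csInf hx hbdd hxS).le
  · obtain ⟨u, -, hu, huS⟩ := exists_seq_tendsto_sInf hne hbdd
    exact ge_of_tendsto' (hcont.tendsto.comp hu) huS

/-- A superlevel set maximizes the integral among all sets of the same measure. -/
theorem setIntegral_le_setIntegral_superlevel {Ω : Type*} [MeasurableSpace Ω] {μ : Measure Ω}
    [IsFiniteMeasure μ] {f : Ω → ℝ} (hf : Integrable f μ) (v : ℝ) {B : Set Ω}
    (hB : MeasurableSet B) (hA : MeasurableSet {p | v ≤ f p})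
    (h : μ.real B = μ.real {p | v ≤ f p}) :
    ∫ p in B, f p ∂μ ≤ ∫ p in {p | v ≤ f p}, f p ∂μ := by
  have hg : Integrable (fun p => f p - v) μ := hf.sub (integrable_const v)
  have key : ∫ p in B, (f p - v) ∂μ ≤ ∫ p in {p | v ≤ f p}, (f p - v) ∂μ := by
    rw [← integral_indicator hB, ← integral_indicator hA]
    refine integral_mono (hg.indicator hB) (hg.indicator hA) fun p => ?_
    by_cases h1 : p ∈ B <;> by_cases h2 : v ≤ f p <;> simp [h1, h2]
    exact (not_le.1 h2).le
  rw [integral_sub hf.integrableOn (integrable_const v),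
    integral_sub hf.integrableOn (integrable_const v), setIntegral_const, setIntegral_const,
    h] at key
  linarith

/-- If for every `p` in the support `D` of `μ` the map `d ↦ r d p` is convex
on `ℝᵐ`, and for every `d` the distribution of `r d ·` has no atom at the value-at-risk
`VaR d`, then the conditional value-at-risk `CVaR` is a convex function of `d` on `ℝᵐ`. -/
theorem stmt_5 (m n : ℕ) (μ : Measure (Fin n → ℝ)) [IsProbabilityMeasure μ]
    (D : Set (Fin n → ℝ)) (hD : IsCompact D) (hμD : μ D = 1)
    (β : ℝ) (hβ : β ∈ Set.Ioo (0 : ℝ) 1)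
    (r : (Fin m → ℝ) → (Fin n → ℝ) → ℝ) (hr : ∀ d, Continuous (r d))
    (Ψ : (Fin m → ℝ) → ℝ → ℝ)
    (hΨ : ∀ d α, Ψ d α = (μ {p | r d p ≤ α}).toReal)
    (VaR : (Fin m → ℝ) → ℝ)
    (hVaR : ∀ d, VaR d = sInf {α : ℝ | β ≤ Ψ d α})
    (CVaR : (Fin m → ℝ) → ℝ)
    (hCVaR : ∀ d, CVaR d = (1 / (1 - β)) * ∫ p in {p | VaR d ≤ r d p}, r d p ∂μ)
    (hconv : ∀ p ∈ D, ConvexOn ℝ Set.univ (fun d : Fin m → ℝ => r d p))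
    (hatom : ∀ d : Fin m → ℝ, μ {p | r d p = VaR d} = 0) :
    ConvexOn ℝ Set.univ CVaR := by
  have hmem : ∀ᵐ p ∂μ, p ∈ D := by
    rw [← mem_ae_iff_prob_eq_one hD.measurableSet] at hμD
    exact hμD
  have hint : ∀ d, Integrable (r d) μ := fun d => by
    have := (hr d).continuousOn.integrableOn_compact (μ := μ) hD
    rwa [IntegrableOn, Measure.restrict_eq_self_of_ae_mem hmem] at this
  have hmeas : ∀ d, MeasurableSet {p | VaR d ≤ r d p} := fun d =>
    measurableSet_le measurable_const (hr d).measurable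
  have htail : ∀ d, μ.real {p | VaR d ≤ r d p} = 1 - β := fun d => by
    have hm := (hr d).measurable
    have : IsProbabilityMeasure (μ.map (r d)) :=
      Measure.isProbabilityMeasure_map hm.aemeasurable
    have hcdf : ∀ α, ProbabilityTheory.cdf (μ.map (r d)) α = Ψ d α := fun α => by
      rw [ProbabilityTheory.cdf_eq_real, map_measureReal_apply hm measurableSet_Iic, hΨ]
      rfl
    have hq := cdf_sInf_eq_of_measure_singleton_eq_zero (μ.map (r d)) hβ (by
      simp only [hcdf, ← hVaR]
      rw [Measure.map_apply hm (measurableSet_singleton _)]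
      exact hatom d)
    simp only [hcdf] at hq
    rw [← hVaR, hΨ] at hq
    have hae : {p | VaR d ≤ r d p} =ᵐ[μ] ({p | r d p ≤ VaR d}ᶜ : Set (Fin n → ℝ)) := by
      have hne : ∀ᵐ p ∂μ, r d p ≠ VaR d := by
        simpa [ae_iff] using hatom d
      filter_upwards [hne] with p hp
      exact propext ⟨fun h => not_le.2 (lt_of_le_of_ne h hp.symm), fun h => (lt_of_not_ge (show ¬ r d p ≤ VaR d from h)).le⟩
    rw [measureReal_congr hae,
      probReal_compl_eq_one_sub (measurableSet_le hm measurable_const), measureReal_def, hq]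
  refine ⟨convex_univ, fun x _ y _ a b ha hb hab => ?_⟩
  set d := a • x + b • y
  set A := {p | VaR d ≤ r d p} with hA
  have hle : ∀ z, ∫ p in A, r z p ∂μ ≤ ∫ p in {p | VaR z ≤ r z p}, r z p ∂μ := fun z =>
    setIntegral_le_setIntegral_superlevel (hint z) _ (hmeas d) (hmeas z)
      ((htail d).trans (htail z).symm)
  have hcomb : ∫ p in A, r d p ∂μ ≤ a * ∫ p in A, r x p ∂μ + b * ∫ p in A, r y p ∂μ := by
    rw [← integral_const_mul, ← integral_const_mul,
      ← integral_add ((hint x).integrableOn.const_mul a) ((hint y).integrableOn.const_mul b)]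
    refine setIntegral_mono_ae (hint d).integrableOn
      (((hint x).const_mul a).add ((hint y).const_mul b)).integrableOn ?_
    filter_upwards [hmem] with p hp
    exact (hconv p hp).2 (Set.mem_univ x) (Set.mem_univ y) ha hb hab
  have hc : 0 ≤ 1 / (1 - β) := by
    have := hβ.2
    exact one_div_nonneg.2 (by linarith)
  rw [hCVaR d, hCVaR x, hCVaR y, smul_eq_mul, smul_eq_mul]
  calc 1 / (1 - β) * ∫ p in A, r d p ∂μ
      ≤ 1 / (1 - β) * (a * ∫ p in {p | VaR x ≤ r x p}, r x p ∂μ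
          + b * ∫ p in {p | VaR y ≤ r y p}, r y p ∂μ) := by
        refine mul_le_mul_of_nonneg_left (hcomb.trans ?_) hc
        exact add_le_add (mul_le_mul_of_nonneg_left (hle x) ha)
          (mul_le_mul_of_nonneg_left (hle y) hb)
    _ = _ := by ring
end

section
/- Assume that for every d ∈ ℝᵐ one has μ({p : r(d,p) = α_β(d)}) = 0. Then inf_{d ∈ ℝᵐ} φ_β(d) = inf_{(α,d) ∈ ℝ × ℝᵐ} R_β(α,d); moreover, a pair (α*, d*) minimizes R_β over ℝ × ℝᵐ if and only if d* minimizes φ_β over ℝᵐ and α* minimizes α ↦ R_β(α, d*) over ℝ. -/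
open MeasureTheory

/-- A probability measure on `ℝ` without an atom at its `β`-quantile has cumulative distribution
function exactly `β` there. -/
theorem cdf_quantile_eq_of_singleton_eq_zero (ν : Measure ℝ) [IsProbabilityMeasure ν]
    {β v : ℝ} (hβ : β ∈ Set.Ioo (0 : ℝ) 1) (hv : v = sInf {α : ℝ | β ≤ ProbabilityTheory.cdf ν α})
    (hatom : ν {v} = 0) : ProbabilityTheory.cdf ν v = β := by
  set F := ProbabilityTheory.cdf ν with hF
  have hmono : Monotone F := F.mono
  have hne : {α : ℝ | β ≤ F α}.Nonempty :=
    ((ProbabilityTheory.tendsto_cdf_atTop ν).eventually_const_le hβ.2).exists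
  obtain ⟨a, ha⟩ := ((ProbabilityTheory.tendsto_cdf_atBot ν).eventually_lt_const hβ.1).exists
  have hbdd : BddBelow {α : ℝ | β ≤ F α} :=
    ⟨a, fun b hb => le_of_lt (hmono.reflect_lt (lt_of_lt_of_le ha hb))⟩
  apply le_antisymm
  · have hleft : Function.leftLim F v ≤ β := by
      refine le_of_tendsto (hmono.tendsto_leftLim v) ?_
      filter_upwards [self_mem_nhdsWithin] with x hx
      by_contra! h
      exact absurd (csInf_le hbdd (show x ∈ {α : ℝ | β ≤ F α} from h.le))
        (not_le.2 (hv ▸ hx))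
    have hjump : ENNReal.ofReal (F v - Function.leftLim F v) = 0 := by
      rw [← F.measure_singleton, hF, ProbabilityTheory.measure_cdf, hatom]
    linarith [ENNReal.ofReal_eq_zero.1 hjump]
  · have hright : Filter.Tendsto F (nhdsWithin v (Set.Ioi v)) (nhds (F v)) :=
      (F.right_continuous v).mono_left (nhdsWithin_mono _ Set.Ioi_subset_Ici_self)
    refine ge_of_tendsto hright ?_
    filter_upwards [self_mem_nhdsWithin] with x hx
    obtain ⟨b, hb, hbx⟩ := exists_lt_of_csInf_lt hne (hv ▸ hx)
    exact le_trans hb (hmono hbx.le)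

/-- A continuous real function is integrable against a finite measure concentrated on a
compact set. -/
theorem Continuous.integrable_of_ae_mem_isCompact {X : Type*} [TopologicalSpace X]
    [MeasurableSpace X] [OpensMeasurableSpace X] {μ : Measure X} [IsFiniteMeasure μ]
    {D : Set X} (hD : IsCompact D) (hμD : ∀ᵐ p ∂μ, p ∈ D) {f : X → ℝ} (hf : Continuous f) :
    Integrable f μ := by
  obtain ⟨C, hC⟩ := hD.exists_bound_of_continuousOn hf.continuousOn
  exact Integrable.of_bound hf.aestronglyMeasurable C (hμD.mono hC)

section UpperTail

variable {Ω : Type*} [MeasurableSpace Ω] {μ : Measure Ω} {f : Ω → ℝ}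

theorem setIntegral_upperTail_sub_const [IsFiniteMeasure μ] (hi : Integrable f μ) (v a : ℝ) :
    ∫ p in {p | v ≤ f p}, (f p - a) ∂μ
      = (∫ p in {p | v ≤ f p}, f p ∂μ) - μ.real {p | v ≤ f p} * a := by
  rw [integral_sub hi.integrableOn (integrable_const a)]
  simp

theorem setIntegral_upperTail_sub_le_integral_max [IsFiniteMeasure μ] (hf : Measurable f)
    (hi : Integrable f μ) (v a : ℝ) :
    ∫ p in {p | v ≤ f p}, (f p - a) ∂μ ≤ ∫ p, max (f p - a) 0 ∂μ := by
  have hm : MeasurableSet {p | v ≤ f p} := measurableSet_le measurable_const hf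
  have hi' : Integrable (fun p => f p - a) μ := hi.sub (integrable_const a)
  rw [← integral_indicator hm]
  refine integral_mono (hi'.indicator hm) hi'.pos_part fun p => ?_
  exact Set.indicator_le' (fun _ _ => le_max_left _ _) (fun _ _ => le_max_right _ _) p

theorem integral_max_sub_eq_setIntegral_upperTail (hf : Measurable f) (v : ℝ) :
    ∫ p, max (f p - v) 0 ∂μ = ∫ p in {p | v ≤ f p}, (f p - v) ∂μ := by
  have hm : MeasurableSet {p | v ≤ f p} := measurableSet_le measurable_const hf
  rw [← integral_indicator hm]
  congr 1
  ext p
  by_cases h : v ≤ f p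
  · simp [h]
  · simp [h, (not_le.1 h).le]

end UpperTail

/-- Without an atom at the `β`-quantile, the upper tail starting there has mass `1 - β`. -/
theorem measureReal_upperTail_quantile {Ω : Type*} [MeasurableSpace Ω] (μ : Measure Ω)
    [IsProbabilityMeasure μ] {f : Ω → ℝ} (hf : Measurable f) {β v : ℝ}
    (hβ : β ∈ Set.Ioo (0 : ℝ) 1) (hv : v = sInf {α : ℝ | β ≤ μ.real {p | f p ≤ α}})
    (hatom : μ {p | f p = v} = 0) : μ.real {p | v ≤ f p} = 1 - β := by
  have : IsProbabilityMeasure (μ.map f) := Measure.isProbabilityMeasure_map hf.aemeasurable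
  have hcdf (α : ℝ) : ProbabilityTheory.cdf (μ.map f) α = μ.real {p | f p ≤ α} := by
    rw [ProbabilityTheory.cdf_eq_real, map_measureReal_apply hf measurableSet_Iic]
    rfl
  have hle : μ.real {p | f p ≤ v} = β := by
    rw [← hcdf]
    refine cdf_quantile_eq_of_singleton_eq_zero _ hβ (by simpa only [hcdf] using hv) ?_
    rw [Measure.map_apply hf (measurableSet_singleton v)]
    exact hatom
  have hcompl : μ.real {p | v ≤ f p} = μ.real ({p | f p ≤ v}ᶜ : Set Ω) := by
    refine measureReal_congr ?_
    have hne : ∀ᵐ p ∂μ, f p ≠ v := by simpa [ae_iff] using hatom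
    filter_upwards [hne] with p hp
    have hiff : v ≤ f p ↔ ¬ f p ≤ v :=
      ⟨fun h => not_le.2 (lt_of_le_of_ne h hp.symm), fun h => (not_le.1 h).le⟩
    exact propext hiff
  rw [hcompl, probReal_compl_eq_one_sub (measurableSet_le hf measurable_const), hle]

/-- Minimizing a function of two variables first in `α`, when each partial minimum is attained:
the infima agree, also when they are unbounded below. -/
theorem ciInf_eq_ciInf_prod_of_le_of_eq {A B : Type*} [Nonempty B] {g : B → ℝ} {R : A → B → ℝ}
    {v : B → A} (hle : ∀ a b, g b ≤ R a b) (heq : ∀ b, R (v b) b = g b) :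
    (⨅ b, g b) = ⨅ x : A × B, R x.1 x.2 := by
  have : Nonempty (A × B) := ⟨(v (Classical.arbitrary B), Classical.arbitrary B)⟩
  by_cases hg : BddBelow (Set.range g)
  · obtain ⟨c, hc⟩ := id hg
    have hR : BddBelow (Set.range fun x : A × B => R x.1 x.2) :=
      ⟨c, by rintro _ ⟨x, rfl⟩; exact (hc ⟨x.2, rfl⟩).trans (hle _ _)⟩
    apply le_antisymm
    · exact le_ciInf fun x => (ciInf_le hg x.2).trans (hle _ _)
    · exact le_ciInf fun b => (ciInf_le hR (v b, b)).trans (heq b).le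
  · have hR : ¬ BddBelow (Set.range fun x : A × B => R x.1 x.2) := fun ⟨c, hc⟩ =>
      hg ⟨c, by rintro _ ⟨b, rfl⟩; exact heq b ▸ hc ⟨(v b, b), rfl⟩⟩
    rw [Real.iInf_of_not_bddBelow hg, Real.iInf_of_not_bddBelow hR]

/-- Assume that for every `d` the distribution of `r d ·` has no atom at the
value-at-risk `VaR d`. Then `⨅ d, CVaR d = ⨅ (α, d), R α d`; moreover `(α*, d*)` minimizes `R`
over `ℝ × ℝᵐ` if and only if `d*` minimizes `CVaR` over `ℝᵐ` and `α*` minimizes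
`α ↦ R α d*` over `ℝ`. -/
theorem stmt_6 (m n : ℕ) (μ : Measure (Fin n → ℝ)) [IsProbabilityMeasure μ]
    (D : Set (Fin n → ℝ)) (hD : IsCompact D) (hμD : μ D = 1)
    (β : ℝ) (hβ : β ∈ Set.Ioo (0 : ℝ) 1)
    (r : (Fin m → ℝ) → (Fin n → ℝ) → ℝ) (hr : ∀ d, Continuous (r d))
    (Ψ : (Fin m → ℝ) → ℝ → ℝ)
    (hΨ : ∀ d α, Ψ d α = (μ {p | r d p ≤ α}).toReal)
    (VaR : (Fin m → ℝ) → ℝ)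
    (hVaR : ∀ d, VaR d = sInf {α : ℝ | β ≤ Ψ d α})
    (CVaR : (Fin m → ℝ) → ℝ)
    (hCVaR : ∀ d, CVaR d = (1 / (1 - β)) * ∫ p in {p | VaR d ≤ r d p}, r d p ∂μ)
    (R : ℝ → (Fin m → ℝ) → ℝ)
    (hR : ∀ α d, R α d = α + (1 / (1 - β)) * ∫ p, max (r d p - α) 0 ∂μ)
    (hatom : ∀ d : Fin m → ℝ, μ {p | r d p = VaR d} = 0) :
    (⨅ d : Fin m → ℝ, CVaR d) = (⨅ x : ℝ × (Fin m → ℝ), R x.1 x.2) ∧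
      ∀ (αstar : ℝ) (dstar : Fin m → ℝ),
        (∀ (α : ℝ) (d : Fin m → ℝ), R αstar dstar ≤ R α d) ↔
          ((∀ d : Fin m → ℝ, CVaR dstar ≤ CVaR d) ∧ ∀ α : ℝ, R αstar dstar ≤ R α dstar) := by
  have hD_ae : ∀ᵐ p ∂μ, p ∈ D := (mem_ae_iff_prob_eq_one hD.measurableSet).2 hμD
  have hβ0 : 0 < 1 - β := by linarith [hβ.2]
  have hint (d) : Integrable (r d) μ := (hr d).integrable_of_ae_mem_isCompact hD hD_ae
  have hmass (d) : μ.real {p | VaR d ≤ r d p} = 1 - β :=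
    measureReal_upperTail_quantile μ (hr d).measurable hβ
      (by simp only [hVaR d, hΨ, Measure.real]) (hatom d)
  have htail (α d) : CVaR d
      = α + (1 / (1 - β)) * ∫ p in {p | VaR d ≤ r d p}, (r d p - α) ∂μ := by
    rw [setIntegral_upperTail_sub_const (hint d), hmass, hCVaR]
    field_simp
    ring
  have hle (α d) : CVaR d ≤ R α d := by
    rw [htail α d, hR]
    gcongr
    exact setIntegral_upperTail_sub_le_integral_max (hr d).measurable (hint d) _ _
  have heq (d) : R (VaR d) d = CVaR d := by
    rw [hR, integral_max_sub_eq_setIntegral_upperTail (hr d).measurable, ← htail]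
  refine ⟨ciInf_eq_ciInf_prod_of_le_of_eq hle heq, fun αs ds =>
    ⟨fun h => ⟨fun d => ?_, fun α => h α ds⟩, fun ⟨h₁, h₂⟩ α d => ?_⟩⟩
  · exact (hle αs ds).trans ((h (VaR d) d).trans (heq d).le)
  · exact (h₂ (VaR ds)).trans ((heq ds).le.trans ((h₁ d).trans (hle α d)))
end
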